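/- Let p = 2a and q = 2b with a, b ≥ 1 and p, q ≥ 2, let G_{p,q} = ⟨x, y | x^p = y^q⟩, and let τ be the automorphism with τ(x) = x⁻¹, τ(y) = y⁻¹. Let w be x or y, let h ∈ G_{p,q}, s ∈ ℤ, and set g = h w^{2s} τ(h)⁻¹. Then the fixed subgroup Fix(ι_g ∘ τ) equals the cyclic subgroup generated by z = h w^s x^a y^{-b} w^{-s} h⁻¹, and z has infinite order; in particular Fix(ι_g ∘ τ) ≅ ℤ. -/

import Mathlib

/-- The torus knot group `⟨x, y | x^p = y^q⟩`, as the presented group obtained as the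
quotient of the free group on two generators by the normal closure of `a^p * b^(-q)`. -/
def TKG (p q : ℕ) : Type :=
  PresentedGroup ({FreeGroup.of true ^ p * (FreeGroup.of false ^ q)⁻¹} : Set (FreeGroup Bool))

instance TKG.instGroup (p q : ℕ) : Group (TKG p q) := by
  delta TKG; infer_instance

/-- The generator `x` of the torus knot group. -/
def TKx (p q : ℕ) : TKG p q := PresentedGroup.of true

/-- The generator `y` of the torus knot group. -/
def TKy (p q : ℕ) : TKG p q := PresentedGroup.of false

/-- The fixed subgroup `Fix(φ) = {h : φ h = h}` of an automorphism `φ`. -/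
def fixSubgroup {G : Type*} [Group G] (φ : G ≃* G) : Subgroup G where
  carrier := {h | φ h = h}
  one_mem' := map_one φ
  mul_mem' := fun ha hb => by
    simp only [Set.mem_setOf_eq] at *
    rw [map_mul, ha, hb]
  inv_mem' := fun ha => by
    simp only [Set.mem_setOf_eq] at *
    rw [map_inv, ha]

theorem TKG_rel (p q : ℕ) : TKx p q ^ p = TKy p q ^ q := by
  have h : (PresentedGroup.mk ({FreeGroup.of true ^ p * (FreeGroup.of false ^ q)⁻¹} :
      Set (FreeGroup Bool))) (FreeGroup.of true ^ p * (FreeGroup.of false ^ q)⁻¹) = 1 :=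
    PresentedGroup.one_of_mem (Set.mem_singleton _)
  rw [map_mul, map_inv, map_pow, map_pow, mul_inv_eq_one] at h
  exact h

theorem TKG_exists_lift {K : Type*} [Group K] (p q : ℕ) (A B : K) (hAB : A ^ p = B ^ q) :
    ∃ f : TKG p q →* K, f (TKx p q) = A ∧ f (TKy p q) = B := by
  have hr : ∀ r ∈ ({FreeGroup.of true ^ p * (FreeGroup.of false ^ q)⁻¹} :
      Set (FreeGroup Bool)), FreeGroup.lift (fun i : Bool => if i then A else B) r = 1 := by
    intro r hr
    rw [Set.mem_singleton_iff] at hr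
    subst hr
    simp [hAB]
  refine ⟨PresentedGroup.toGroup hr, ?_, ?_⟩
  · exact (PresentedGroup.toGroup.of hr).trans (by simp)
  · exact (PresentedGroup.toGroup.of hr).trans (by simp)

theorem TKG_hom_ext {K : Type*} [Group K] {p q : ℕ} {f g : TKG p q →* K}
    (hx : f (TKx p q) = g (TKx p q)) (hy : f (TKy p q) = g (TKy p q)) : f = g := by
  apply PresentedGroup.ext
  intro i
  cases i
  · exact hy
  · exact hx

theorem TKG_central (p q : ℕ) (u : TKG p q) : TKx p q ^ p * u = u * TKx p q ^ p := by
  have h : (MulAut.conj (TKx p q ^ p)).toMonoidHom = MonoidHom.id (TKG p q) := by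
    apply TKG_hom_ext
    · simp only [MulEquiv.toMonoidHom_eq_coe, MonoidHom.coe_coe, MulAut.conj_apply,
        MonoidHom.id_apply]
      group
    · simp only [MulEquiv.toMonoidHom_eq_coe, MonoidHom.coe_coe, MulAut.conj_apply,
        MonoidHom.id_apply, TKG_rel]
      group
  have h2 := DFunLike.congr_fun h u
  simp only [MulEquiv.toMonoidHom_eq_coe, MonoidHom.coe_coe, MulAut.conj_apply,
        MonoidHom.id_apply] at h2
  exact mul_inv_eq_iff_eq_mul.mp h2

/-- The central element has infinite order. -/
theorem TKG_central_zpow (p q : ℕ) (hp : 1 ≤ p) (hq : 1 ≤ q) (k : ℤ)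
    (h : (TKx p q ^ p) ^ k = 1) : k = 0 := by
  obtain ⟨f, hfx, -⟩ := TKG_exists_lift p q (Multiplicative.ofAdd (q : ℤ))
    (Multiplicative.ofAdd (p : ℤ)) (by
      rw [← ofAdd_nsmul, ← ofAdd_nsmul]
      simp [mul_comm])
  have h2 := congrArg f h
  rw [map_zpow, map_pow, hfx, map_one, ← ofAdd_nsmul, ← ofAdd_zsmul, ofAdd_eq_one] at h2
  simp only [smul_eq_mul, nsmul_eq_mul, mul_eq_zero] at h2
  omega

/-- Half-orders of the two cyclic factors. -/
def TKn (a b : ℕ) (i : Bool) : ℕ := if i then a else b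

/-- The cyclic factors. -/
abbrev TKM (a b : ℕ) (i : Bool) : Type := Multiplicative (ZMod (2 * TKn a b i))

/-- The involution in each factor. -/
def TKt (a b : ℕ) (i : Bool) : TKM a b i := Multiplicative.ofAdd ((TKn a b i : ℕ) : ZMod _)

theorem TKM_involution (n : ℕ) (hn : 1 ≤ n) (m : ZMod (2 * n)) (h0 : m ≠ 0) (h : -m = m) :
    m = (n : ZMod (2 * n)) := by
  haveI : NeZero (2 * n) := ⟨by omega⟩
  have h1 : ((2 * m.val : ℕ) : ZMod (2 * n)) = 0 := by
    push_cast
    rw [ZMod.natCast_zmod_val]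
    have h' : m + m = 0 := by
      nth_rewrite 1 [← h]
      exact neg_add_cancel m
    linear_combination h'
  rw [ZMod.natCast_eq_zero_iff] at h1
  have h2 : m.val < 2 * n := ZMod.val_lt m
  have h3 : m.val ≠ 0 := by rwa [Ne, ZMod.val_eq_zero]
  have h4 : n ∣ m.val := Nat.dvd_of_mul_dvd_mul_left (by norm_num) h1
  obtain ⟨c, hc⟩ := h4
  have h5 : c < 2 := by
    by_contra! hcon
    nlinarith
  have h6 : c ≠ 0 := by
    rintro rfl
    simp at hc
    exact h3 (by simp [hc])
  have h7 : c = 1 := by omega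
  rw [h7, mul_one] at hc
  have h8 := congrArg (Nat.cast : ℕ → ZMod (2 * n)) hc
  rwa [ZMod.natCast_zmod_val] at h8

theorem TKt_ne_one (a b : ℕ) (ha : 1 ≤ a) (hb : 1 ≤ b) (i : Bool) : TKt a b i ≠ 1 := by
  have hn : 1 ≤ TKn a b i := by cases i <;> simpa [TKn]
  unfold TKt
  rw [Ne, ofAdd_eq_one, ZMod.natCast_eq_zero_iff]
  intro h
  have := Nat.le_of_dvd (by omega) h
  omega

open Monoid in
/-- Letterwise inversion of words. -/
def TKwordInv {ι : Type*} {M : ι → Type*} [∀ i, Group (M i)] (v : CoprodI.Word M) :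
    CoprodI.Word M where
  toList := v.toList.map (fun l => ⟨l.1, l.2⁻¹⟩)
  ne_one := by
    intro l hl
    rw [List.mem_map] at hl
    obtain ⟨l', hl', rfl⟩ := hl
    simpa using v.ne_one l' hl'
  chain_ne := by
    rw [List.isChain_map]
    exact v.chain_ne

open Monoid in
theorem TKword_fixed {ι : Type*} {M : ι → Type*} [DecidableEq ι] [∀ i, Group (M i)]
    [∀ i, DecidableEq (M i)]
    (φ : CoprodI M →* CoprodI M)
    (hφ : ∀ i (m : M i), φ (CoprodI.of m) = CoprodI.of m⁻¹)
    (v : CoprodI.Word M) (hv : φ v.prod = v.prod) :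
    ∀ l ∈ v.toList, l.2⁻¹ = l.2 := by
  have h1 : φ v.prod = (TKwordInv v).prod := by
    unfold CoprodI.Word.prod TKwordInv
    rw [map_list_prod, List.map_map, List.map_map]
    congr 1
    apply List.map_congr_left
    intro l _
    simp [hφ]
  rw [h1] at hv
  have h2 : TKwordInv v = v := CoprodI.Word.equiv.symm.injective hv
  have h3 : v.toList.map (fun l => (⟨l.1, l.2⁻¹⟩ : Σ i, M i)) = v.toList :=
    congrArg CoprodI.Word.toList h2
  intro l hl
  have h4 : v.toList.map (fun l => (⟨l.1, l.2⁻¹⟩ : Σ i, M i)) = v.toList.map id := by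
    rw [h3, List.map_id]
  have h5 := List.map_inj_left.mp h4 l hl
  obtain ⟨i, m⟩ := l
  simpa using h5

open Monoid in
theorem TKword_pow_ne_one (a b : ℕ) (ha : 1 ≤ a) (hb : 1 ≤ b) (n : ℕ) :
    ((CoprodI.of (TKt a b true) : CoprodI (TKM a b)) * CoprodI.of (TKt a b false)) ^ (n + 1)
      ≠ 1 := by
  have key : ∀ n : ℕ, ∃ w : CoprodI.NeWord (TKM a b) true false,
      w.prod = ((CoprodI.of (TKt a b true) : CoprodI (TKM a b)) *
        CoprodI.of (TKt a b false)) ^ (n + 1) := by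
    let w0 : CoprodI.NeWord (TKM a b) true false :=
      CoprodI.NeWord.append (CoprodI.NeWord.singleton _ (TKt_ne_one a b ha hb true))
        (by decide) (CoprodI.NeWord.singleton _ (TKt_ne_one a b ha hb false))
    have hw0 : w0.prod = (CoprodI.of (TKt a b true) : CoprodI (TKM a b)) *
        CoprodI.of (TKt a b false) := by
      simp [w0]
    intro n
    induction n with
    | zero => exact ⟨w0, by simpa using hw0⟩
    | succ n ih =>
      obtain ⟨w, hw⟩ := ih
      refine ⟨CoprodI.NeWord.append w (by decide) w0, ?_⟩
      rw [CoprodI.NeWord.append_prod, hw, hw0, ← pow_succ]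
  obtain ⟨w, hw⟩ := key n
  rw [← hw]
  intro h1
  classical
  have h2 : w.toWord = CoprodI.Word.empty := by
    apply CoprodI.Word.equiv.symm.injective
    exact h1
  exact w.toList_ne_nil (congrArg CoprodI.Word.toList h2)

open Monoid in
/-- The projection to the free product of cyclic groups, and its properties. -/
theorem TKG_proj (a b : ℕ) :
    ∃ π : TKG (2 * a) (2 * b) →* CoprodI (TKM a b),
      π (TKx (2 * a) (2 * b) ^ a) = CoprodI.of (TKt a b true) ∧
      π (TKy (2 * a) (2 * b) ^ b) = CoprodI.of (TKt a b false) ∧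
      (∀ u, π u = 1 → u ∈ Subgroup.zpowers (TKx (2 * a) (2 * b) ^ (2 * a))) ∧
      ∀ τ : MulAut (TKG (2 * a) (2 * b)),
        τ (TKx (2 * a) (2 * b)) = (TKx (2 * a) (2 * b))⁻¹ →
        τ (TKy (2 * a) (2 * b)) = (TKy (2 * a) (2 * b))⁻¹ →
        ∃ φ : CoprodI (TKM a b) →* CoprodI (TKM a b),
          (∀ i (m : TKM a b i), φ (CoprodI.of m) = CoprodI.of m⁻¹) ∧
          ∀ u, π (τ u) = φ (π u) := by
  let e : ∀ i, TKM a b i := fun i => Multiplicative.ofAdd 1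
  have he : ∀ i (k : ℕ), e i ^ k = Multiplicative.ofAdd (k : ZMod (2 * TKn a b i)) := by
    intro i k
    simp only [e]
    rw [← ofAdd_nsmul, nsmul_one]
  have he2 : ∀ i, e i ^ (2 * TKn a b i) = 1 := by
    intro i
    rw [he, ZMod.natCast_self, ofAdd_zero]
  obtain ⟨π, hx, hy⟩ := TKG_exists_lift (2 * a) (2 * b)
    (CoprodI.of (e true) : CoprodI (TKM a b)) (CoprodI.of (e false)) (by
      have h1 := he2 true
      have h2 := he2 false
      have h3 : (CoprodI.of (e true) : CoprodI (TKM a b)) ^ (2 * TKn a b true) = 1 := by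
        rw [← MonoidHom.map_pow, h1, MonoidHom.map_one]
      have h4 : (CoprodI.of (e false) : CoprodI (TKM a b)) ^ (2 * TKn a b false) = 1 := by
        rw [← MonoidHom.map_pow, h2, MonoidHom.map_one]
      exact h3.trans h4.symm)
  refine ⟨π, ?_, ?_, ?_, ?_⟩
  · rw [map_pow, hx, ← MonoidHom.map_pow CoprodI.of]
    exact congrArg CoprodI.of (he true a)
  · rw [map_pow, hy, ← MonoidHom.map_pow CoprodI.of]
    exact congrArg CoprodI.of (he false b)
  · set C := Subgroup.zpowers (TKx (2 * a) (2 * b) ^ (2 * a)) with hC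
    haveI : C.Normal := by
      constructor
      intro n hn u
      obtain ⟨k, rfl⟩ := Subgroup.mem_zpowers_iff.mp hn
      have hc : Commute (TKx (2 * a) (2 * b) ^ (2 * a)) u := TKG_central _ _ u
      have := (hc.zpow_left k).eq
      rw [← this, mul_inv_cancel_right]
      exact hn
    let gen : Bool → TKG (2 * a) (2 * b) := fun i =>
      if i then TKx (2 * a) (2 * b) else TKy (2 * a) (2 * b)
    have hgen : ∀ i, (QuotientGroup.mk' C (gen i)) ^ (2 * TKn a b i) = 1 := by
      intro i
      rw [← map_pow]
      apply (QuotientGroup.eq_one_iff _).mpr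
      cases i
      · change TKy (2 * a) (2 * b) ^ (2 * b) ∈ C
        rw [← TKG_rel]
        exact Subgroup.mem_zpowers _
      · change TKx (2 * a) (2 * b) ^ (2 * a) ∈ C
        exact Subgroup.mem_zpowers _
    have hex : ∀ i, ∃ f : TKM a b i →* (TKG (2 * a) (2 * b) ⧸ C),
        f (e i) = QuotientGroup.mk' C (gen i) := by
      intro i
      let f0 : ℤ →+ Additive (TKG (2 * a) (2 * b) ⧸ C) :=
        zmultiplesHom _ (Additive.ofMul (QuotientGroup.mk' C (gen i)))
      have hf0 : f0 ((2 * TKn a b i : ℕ) : ℤ) = 0 := by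
        simp only [f0, zmultiplesHom_apply, natCast_zsmul]
        rw [← ofMul_pow, hgen, ofMul_one]
      let f1 := ZMod.lift (2 * TKn a b i) ⟨f0, hf0⟩
      refine ⟨AddMonoidHom.toMultiplicativeLeft f1, ?_⟩
      have : f1 ((1 : ℤ) : ZMod (2 * TKn a b i)) = f0 1 := ZMod.lift_coe _ _ _
      rw [Int.cast_one] at this
      have h1 : f0 1 = Additive.ofMul (QuotientGroup.mk' C (gen i)) := by
        simp [f0]
      rw [h1] at this
      exact congrArg Additive.toMul this
    choose f hf using hex
    have hcomp : (CoprodI.lift f).comp π = QuotientGroup.mk' C := by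
      apply TKG_hom_ext
      · rw [MonoidHom.comp_apply, hx, CoprodI.lift_of, hf]
        rfl
      · rw [MonoidHom.comp_apply, hy, CoprodI.lift_of, hf]
        rfl
    intro u hu
    have h1 := DFunLike.congr_fun hcomp u
    rw [MonoidHom.comp_apply, hu, map_one] at h1
    exact (QuotientGroup.eq_one_iff u).mp h1.symm
  · intro τ hτx hτy
    let φ : CoprodI (TKM a b) →* CoprodI (TKM a b) :=
      CoprodI.lift (fun i => (CoprodI.of).comp (invMonoidHom (α := TKM a b i)))
    have hφ : ∀ i (m : TKM a b i), φ (CoprodI.of m) = CoprodI.of m⁻¹ := by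
      intro i m
      simp only [φ, CoprodI.lift_of]
      rfl
    refine ⟨φ, hφ, ?_⟩
    have hcomp : π.comp τ.toMonoidHom = φ.comp π := by
      apply TKG_hom_ext
      · simp [hτx, hx, hφ]
      · simp [hτy, hy, hφ]
    intro u
    exact DFunLike.congr_fun hcomp u

/-- If `X² = Y²`, every element of `⟨X, Y⟩` has the form `(X Y⁻¹)^m X^k`. -/
theorem TK_dihedral_form {G : Type*} [Group G] (X Y : G) (hXY : X ^ 2 = Y ^ 2) (u : G)
    (hu : u ∈ Subgroup.closure ({X, Y} : Set G)) :
    ∃ m k : ℤ, u = (X * Y⁻¹) ^ m * X ^ k := by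
  have hinv : X * (X * Y⁻¹) * X⁻¹ = (X * Y⁻¹)⁻¹ := by
    calc X * (X * Y⁻¹) * X⁻¹ = X ^ 2 * Y⁻¹ * X⁻¹ := by
          rw [sq, mul_assoc X X Y⁻¹]
      _ = Y ^ 2 * Y⁻¹ * X⁻¹ := by rw [hXY]
      _ = (X * Y⁻¹)⁻¹ := by group
  have hX : ∀ m : ℤ, X * (X * Y⁻¹) ^ m = (X * Y⁻¹) ^ (-m) * X := by
    intro m
    have : X * (X * Y⁻¹) ^ m * X⁻¹ = (X * Y⁻¹) ^ (-m) := by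
      rw [← conj_zpow, hinv, inv_zpow, zpow_neg]
    rw [← this]
    group
  have hX' : ∀ m : ℤ, X⁻¹ * (X * Y⁻¹) ^ m = (X * Y⁻¹) ^ (-m) * X⁻¹ := by
    intro m
    have := hX (-m)
    rw [neg_neg] at this
    rw [inv_mul_eq_iff_eq_mul, ← mul_assoc, this, mul_assoc, mul_inv_cancel, mul_one]
  have hYe : Y = (X * Y⁻¹) ^ (-1 : ℤ) * X := by group
  have hYe' : Y⁻¹ = X⁻¹ * (X * Y⁻¹) ^ (1 : ℤ) := by group
  induction hu using Subgroup.closure_induction_left with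
  | one => exact ⟨0, 0, by simp⟩
  | mul_left x hx y hy ih =>
    obtain ⟨m, k, rfl⟩ := ih
    have hXcase : ∀ m k : ℤ, X * ((X * Y⁻¹) ^ m * X ^ k) = (X * Y⁻¹) ^ (-m) * X ^ (1 + k) := by
      intro m k
      rw [← mul_assoc, hX, mul_assoc, ← zpow_one_add]
    rcases hx with rfl | rfl
    · exact ⟨-m, 1 + k, hXcase m k⟩
    · refine ⟨-1 + -m, 1 + k, ?_⟩
      nth_rewrite 1 [hYe]
      rw [mul_assoc, hXcase, zpow_add _ (-1) (-m), mul_assoc]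
  | inv_mul_cancel x hx y hy ih =>
    obtain ⟨m, k, rfl⟩ := ih
    have hXcase : ∀ m k : ℤ, X⁻¹ * ((X * Y⁻¹) ^ m * X ^ k) =
        (X * Y⁻¹) ^ (-m) * X ^ (-1 + k) := by
      intro m k
      rw [← mul_assoc, hX', mul_assoc, zpow_add, zpow_neg_one]
    rcases hx with rfl | rfl
    · exact ⟨-m, -1 + k, hXcase m k⟩
    · refine ⟨-(1 + m), -1 + k, ?_⟩
      nth_rewrite 1 [hYe']
      rw [mul_assoc, ← mul_assoc ((X * x⁻¹) ^ (1 : ℤ)), ← zpow_add, hXcase]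

open Monoid in
theorem TKG_fix_core (a b : ℕ) (ha : 1 ≤ a) (hb : 1 ≤ b)
    (τ : MulAut (TKG (2 * a) (2 * b)))
    (hτx : τ (TKx (2 * a) (2 * b)) = (TKx (2 * a) (2 * b))⁻¹)
    (hτy : τ (TKy (2 * a) (2 * b)) = (TKy (2 * a) (2 * b))⁻¹) :
    (∀ u, τ u = u ↔ u ∈ Subgroup.zpowers
      (TKx (2 * a) (2 * b) ^ a * (TKy (2 * a) (2 * b) ^ b)⁻¹)) ∧
    ∀ n : ℕ, (TKx (2 * a) (2 * b) ^ a * (TKy (2 * a) (2 * b) ^ b)⁻¹) ^ (n + 1) ≠ 1 := by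
  classical
  obtain ⟨π, hπX, hπY, hker, hφ0⟩ := TKG_proj a b
  obtain ⟨φ, hφ, hφπ⟩ := hφ0 τ hτx hτy
  set x := TKx (2 * a) (2 * b) with hxdef
  set y := TKy (2 * a) (2 * b) with hydef
  have hXX : (x ^ a) ^ 2 = x ^ (2 * a) := (pow_mul' x 2 a).symm
  have hYY : (y ^ b) ^ 2 = y ^ (2 * b) := (pow_mul' y 2 b).symm
  have hXY : (x ^ a) ^ 2 = (y ^ b) ^ 2 := by rw [hXX, hYY]; exact TKG_rel _ _
  have hτX : τ (x ^ a) = (x ^ a)⁻¹ := by rw [map_pow, hτx, inv_pow]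
  have hτY : τ (y ^ b) = (y ^ b)⁻¹ := by rw [map_pow, hτy, inv_pow]
  have hc0 : ∀ k : ℤ, ((x ^ a) ^ 2) ^ k = 1 → k = 0 := by
    intro k hk
    rw [hXX] at hk
    exact TKG_central_zpow _ _ (by omega) (by omega) k hk
  have hcl : ∀ u, τ u = u → u ∈ Subgroup.closure ({x ^ a, y ^ b} : Set _) := by
    intro u hu
    have h1 : φ (π u) = π u := by rw [← hφπ, hu]
    have hv : (CoprodI.Word.equiv (π u)).prod = π u := CoprodI.Word.equiv.symm_apply_apply _
    set v := CoprodI.Word.equiv (π u)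
    have h2 := TKword_fixed φ hφ v (by rw [hv, h1])
    have h3 : π u ∈ (Subgroup.closure ({x ^ a, y ^ b} : Set _)).map π := by
      rw [← hv]
      unfold CoprodI.Word.prod
      apply Subgroup.list_prod_mem
      intro z hz
      rw [List.mem_map] at hz
      obtain ⟨⟨i, m⟩, hl, rfl⟩ := hz
      have hm1 : m ≠ 1 := v.ne_one _ hl
      have hm2 : m⁻¹ = m := h2 _ hl
      have hn : 1 ≤ TKn a b i := by cases i <;> simpa [TKn]
      have hm : m = TKt a b i := TKM_involution (TKn a b i) hn m hm1 hm2
      rw [hm]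
      cases i
      · exact ⟨y ^ b, Subgroup.subset_closure (by simp), hπY⟩
      · exact ⟨x ^ a, Subgroup.subset_closure (by simp), hπX⟩
    obtain ⟨u', hu', hu''⟩ := h3
    have h4 : u'⁻¹ * u ∈ Subgroup.zpowers (x ^ (2 * a)) :=
      hker _ (by rw [map_mul, map_inv, hu'', inv_mul_cancel])
    have h5 : Subgroup.zpowers (x ^ (2 * a)) ≤ Subgroup.closure ({x ^ a, y ^ b} : Set _) := by
      rw [Subgroup.zpowers_le, ← hXX]
      exact Subgroup.pow_mem _ (Subgroup.subset_closure (by simp)) 2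
    have h6 := Subgroup.mul_mem _ hu' (h5 h4)
    rwa [mul_inv_cancel_left] at h6
  have hτXY : τ (x ^ a * (y ^ b)⁻¹) = x ^ a * (y ^ b)⁻¹ := by
    rw [map_mul, map_inv, hτX, hτY, inv_inv]
    rw [inv_mul_eq_iff_eq_mul, ← mul_assoc, ← sq, hXY, sq, mul_inv_cancel_right]
  refine ⟨fun u => ⟨fun hu => ?_, fun hu => ?_⟩, ?_⟩
  · obtain ⟨m, k, rfl⟩ := TK_dihedral_form _ _ hXY u (hcl u hu)
    rw [map_mul, map_zpow, map_zpow, hτXY, hτX] at hu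
    have h1 := mul_left_cancel hu
    have h2 : ((x ^ a) ^ 2) ^ k = 1 := by
      rw [sq, (Commute.refl (x ^ a)).mul_zpow]
      nth_rewrite 1 [← h1]
      rw [inv_zpow, inv_mul_cancel]
    rw [hc0 k h2, zpow_zero, mul_one]
    exact Subgroup.zpow_mem_zpowers _ _
  · obtain ⟨k, rfl⟩ := Subgroup.mem_zpowers_iff.mp hu
    rw [map_zpow, hτXY]
  · intro n hn
    have h1 := congrArg π hn
    have h2 : (CoprodI.of (TKt a b false) : CoprodI (TKM a b))⁻¹ =
        CoprodI.of (TKt a b false) := by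
      rw [← map_inv]
      congr 1
      unfold TKt
      rw [← ofAdd_neg]
      congr 1
      rw [neg_eq_iff_add_eq_zero, ← Nat.cast_add, ← two_mul, ZMod.natCast_self]
    rw [map_pow, map_mul, map_inv, hπX, hπY, h2, map_one] at h1
    exact TKword_pow_ne_one a b ha hb n h1

/-- Let `p = 2a`, `q = 2b` with `a, b ≥ 1`, let `w ∈ {x, y}` and `g = h w^(2s) τ(h)⁻¹`.
Then `Fix(ι_g ∘ τ)` is the infinite cyclic subgroup generated by
`z = h w^s x^a y^(-b) w^(-s) h⁻¹`; in particular it is isomorphic to `ℤ`. -/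
theorem TKG_fix_tau_g_even_case (a b : ℕ) (ha : 1 ≤ a) (hb : 1 ≤ b)
    (τ : MulAut (TKG (2 * a) (2 * b)))
    (hτx : τ (TKx (2 * a) (2 * b)) = (TKx (2 * a) (2 * b))⁻¹)
    (hτy : τ (TKy (2 * a) (2 * b)) = (TKy (2 * a) (2 * b))⁻¹)
    (w : TKG (2 * a) (2 * b))
    (hw : w = TKx (2 * a) (2 * b) ∨ w = TKy (2 * a) (2 * b))
    (h : TKG (2 * a) (2 * b)) (s : ℤ)
    (g : TKG (2 * a) (2 * b)) (hg : g = h * w ^ (2 * s) * (τ h)⁻¹) :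
    fixSubgroup (MulAut.conj g * τ) =
      Subgroup.zpowers
        (h * w ^ s * TKx (2 * a) (2 * b) ^ a * TKy (2 * a) (2 * b) ^ (-(b : ℤ)) *
          w ^ (-s) * h⁻¹) ∧
    ¬ IsOfFinOrder
        (h * w ^ s * TKx (2 * a) (2 * b) ^ a * TKy (2 * a) (2 * b) ^ (-(b : ℤ)) *
          w ^ (-s) * h⁻¹) := by
  obtain ⟨hfix, hord⟩ := TKG_fix_core a b ha hb τ hτx hτy
  have hτw : τ w = w⁻¹ := by
    rcases hw with rfl | rfl
    · exact hτx
    · exact hτy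
  set X := TKx (2 * a) (2 * b) ^ a
  have hYb : TKy (2 * a) (2 * b) ^ (-(b : ℤ)) = (TKy (2 * a) (2 * b) ^ b)⁻¹ := by
    rw [zpow_neg, zpow_natCast]
  rw [hYb]
  set Y := TKy (2 * a) (2 * b) ^ b
  have hz : h * w ^ s * X * Y⁻¹ * w ^ (-s) * h⁻¹ =
      (h * w ^ s) * (X * Y⁻¹) * (h * w ^ s)⁻¹ := by
    rw [zpow_neg, mul_inv_rev]
    simp only [mul_assoc]
  rw [hz]
  have hgk : g = (h * w ^ s) * (τ (h * w ^ s))⁻¹ := by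
    rw [hg, map_mul, map_zpow, hτw, mul_inv_rev, inv_zpow, inv_inv, two_mul s, zpow_add]
    simp only [mul_assoc]
  generalize h * w ^ s = k at *
  constructor
  · ext u
    have h1 : u ∈ fixSubgroup (MulAut.conj g * τ) ↔ τ (k⁻¹ * u * k) = k⁻¹ * u * k := by
      change (MulAut.conj g * τ) u = u ↔ _
      rw [MulAut.mul_apply, MulAut.conj_apply, hgk, map_mul, map_mul, map_inv]
      constructor
      · intro h2
        nth_rewrite 2 [← h2]
        group
      · intro h2
        calc k * (τ k)⁻¹ * τ u * (k * (τ k)⁻¹)⁻¹ = k * ((τ k)⁻¹ * τ u * τ k) * k⁻¹ := by group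
          _ = u := by rw [h2]; group
    rw [h1, hfix, Subgroup.mem_zpowers_iff, Subgroup.mem_zpowers_iff]
    constructor
    · rintro ⟨m, hm⟩
      refine ⟨m, ?_⟩
      rw [conj_zpow, hm]
      group
    · rintro ⟨m, hm⟩
      refine ⟨m, ?_⟩
      rw [← hm, conj_zpow]
      group
  · intro hfin
    rw [isOfFinOrder_iff_pow_eq_one] at hfin
    obtain ⟨n, hn, hn1⟩ := hfin
    rw [conj_pow, mul_inv_eq_one, mul_eq_left] at hn1
    obtain ⟨m, rfl⟩ : ∃ m, n = m + 1 := ⟨n - 1, by omega⟩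
    exact hord m hn1
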